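/- arXiv:2312.10106 — 2 statements merged into one kernel-verified Lean document; each statement's English description precedes it below -/
import Mathlib

section
/- Let (Ω, 𝒜, P) be a probability space and let X, Y be independent real random variables, each with standard Gaussian distribution N(0,1). Fix a ∈ (0,1) and ω₀ ∈ [0,π], and define the random function f(z) = (X − a(X·cos ω₀ − Y·sin ω₀)·z⁻¹) / (1 − 2a·cos(ω₀)·z⁻¹ + a²·z⁻²). Then for all z, w ∈ ℂ with |z| ≥ 1 and |w| ≥ 1: E[f(z)·conj(f(w))] = (1 − a·cos(ω₀)·(z⁻¹ + conj(w)⁻¹) + a²·(z·conj(w))⁻¹) / ((1 − 2a·cos(ω₀)·z⁻¹ + a²·z⁻²)·(1 − 2a·cos(ω₀)·conj(w)⁻¹ + a²·conj(w)⁻²)), and E[f(z)·f(w)] = (1 − a·cos(ω₀)·(z⁻¹ + w⁻¹) + a²·(z·w)⁻¹) / ((1 − 2a·cos(ω₀)·z⁻¹ + a²·z⁻²)·(1 − 2a·cos(ω₀)·w⁻¹ + a²·w⁻²)). -/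
open MeasureTheory ProbabilityTheory ComplexConjugate

theorem memLp_two_of_map_eq_gaussianReal {Ω : Type*} [MeasurableSpace Ω] {P : Measure Ω}
    {X : Ω → ℝ} (hX : Measurable X) {m : ℝ} {v : NNReal} (h : P.map X = gaussianReal m v) :
    MemLp X 2 P :=
  (h ▸ memLp_id_gaussianReal 2 : MemLp id 2 (P.map X)).comp_of_map hX.aemeasurable

theorem integral_eq_of_map_eq_gaussianReal {Ω : Type*} [MeasurableSpace Ω] {P : Measure Ω}
    {X : Ω → ℝ} (hX : Measurable X) {m : ℝ} {v : NNReal} (h : P.map X = gaussianReal m v) :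
    ∫ ω, X ω ∂P = m := by
  rw [(HasLaw.mk hX.aemeasurable h).integral_eq, integral_id_gaussianReal]

theorem integral_sq_of_map_eq_gaussianReal_zero {Ω : Type*} [MeasurableSpace Ω] {P : Measure Ω}
    {X : Ω → ℝ} (hX : Measurable X) {v : NNReal} (h : P.map X = gaussianReal 0 v) :
    ∫ ω, X ω ^ 2 ∂P = v := by
  rw [← variance_of_integral_eq_zero hX.aemeasurable (integral_eq_of_map_eq_gaussianReal hX h),
    (HasLaw.mk hX.aemeasurable h).variance_eq, variance_id_gaussianReal]

/-- The bilinear second moment of two complex linear combinations of independent standard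
Gaussian variables. -/
theorem integral_mul_linear_combination_gaussian {Ω : Type*} [MeasurableSpace Ω] {P : Measure Ω}
    {X Y : Ω → ℝ} (hX : Measurable X) (hY : Measurable Y) (hXY : IndepFun X Y P)
    (hXlaw : P.map X = gaussianReal 0 1) (hYlaw : P.map Y = gaussianReal 0 1) (α β γ δ : ℂ) :
    ∫ ω, (α * X ω + β * Y ω) * (γ * X ω + δ * Y ω) ∂P = α * γ + β * δ := by
  have hX₂ := memLp_two_of_map_eq_gaussianReal hX hXlaw
  have hY₂ := memLp_two_of_map_eq_gaussianReal hY hYlaw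
  have iXX : Integrable (fun ω ↦ ((X ω ^ 2 : ℝ) : ℂ)) P := hX₂.integrable_sq.ofReal
  have iYY : Integrable (fun ω ↦ ((Y ω ^ 2 : ℝ) : ℂ)) P := hY₂.integrable_sq.ofReal
  have iXY : Integrable (fun ω ↦ ((X ω * Y ω : ℝ) : ℂ)) P := (hX₂.integrable_mul hY₂).ofReal
  have eXX := integral_sq_of_map_eq_gaussianReal_zero hX hXlaw
  have eYY := integral_sq_of_map_eq_gaussianReal_zero hY hYlaw
  have eXY : ∫ ω, X ω * Y ω ∂P = 0 := by
    rw [hXY.integral_fun_mul_eq_mul_integral hX.aestronglyMeasurable hY.aestronglyMeasurable,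
      integral_eq_of_map_eq_gaussianReal hX hXlaw, zero_mul]
  calc ∫ ω, (α * X ω + β * Y ω) * (γ * X ω + δ * Y ω) ∂P
      = ∫ ω, (α * γ * ((X ω ^ 2 : ℝ) : ℂ) + β * δ * ((Y ω ^ 2 : ℝ) : ℂ)
          + (α * δ + β * γ) * ((X ω * Y ω : ℝ) : ℂ)) ∂P := by
        congr 1 with ω
        push_cast
        ring
    _ = α * γ + β * δ := by
        rw [integral_add (by fun_prop) (by fun_prop),
          integral_add (by fun_prop) (by fun_prop)]
        simp only [integral_const_mul, integral_complex_ofReal, eXX, eYY, eXY]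
        simp

/-- Hermitian and complementary covariances of the "cozine" process. -/
theorem cozine_process_covariances
    {Ω : Type*} [MeasurableSpace Ω] (P : Measure Ω) [IsProbabilityMeasure P]
    (X Y : Ω → ℝ) (hX : Measurable X) (hY : Measurable Y)
    (hXY : IndepFun X Y P)
    (hXlaw : P.map X = gaussianReal 0 1) (hYlaw : P.map Y = gaussianReal 0 1)
    (a ω₀ : ℝ) (ha : a ∈ Set.Ioo (0 : ℝ) 1) (hω₀ : ω₀ ∈ Set.Icc (0 : ℝ) Real.pi)
    (f : ℂ → Ω → ℂ)
    (hf : ∀ z ω, f z ω =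
      ((X ω : ℂ) - (a : ℂ) * ((X ω : ℂ) * (Real.cos ω₀ : ℂ) - (Y ω : ℂ) * (Real.sin ω₀ : ℂ)) * z⁻¹) /
        (1 - 2 * (a : ℂ) * (Real.cos ω₀ : ℂ) * z⁻¹ + (a : ℂ) ^ 2 * (z ^ 2)⁻¹)) :
    ∀ z w : ℂ, 1 ≤ ‖z‖ → 1 ≤ ‖w‖ →
      (∫ ω, f z ω * conj (f w ω) ∂P =
        (1 - (a : ℂ) * (Real.cos ω₀ : ℂ) * (z⁻¹ + (conj w)⁻¹) + (a : ℂ) ^ 2 * (z * conj w)⁻¹) /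
          ((1 - 2 * (a : ℂ) * (Real.cos ω₀ : ℂ) * z⁻¹ + (a : ℂ) ^ 2 * (z ^ 2)⁻¹) *
            (1 - 2 * (a : ℂ) * (Real.cos ω₀ : ℂ) * (conj w)⁻¹ + (a : ℂ) ^ 2 * ((conj w) ^ 2)⁻¹))) ∧
      (∫ ω, f z ω * f w ω ∂P =
        (1 - (a : ℂ) * (Real.cos ω₀ : ℂ) * (z⁻¹ + w⁻¹) + (a : ℂ) ^ 2 * (z * w)⁻¹) /
          ((1 - 2 * (a : ℂ) * (Real.cos ω₀ : ℂ) * z⁻¹ + (a : ℂ) ^ 2 * (z ^ 2)⁻¹) *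
            (1 - 2 * (a : ℂ) * (Real.cos ω₀ : ℂ) * w⁻¹ + (a : ℂ) ^ 2 * (w ^ 2)⁻¹))) := by
  have hconj (w : ℂ) (ω : Ω) : conj (f w ω) = f (conj w) ω := by
    simp only [hf, map_div₀, map_sub, map_add, map_mul, map_pow, map_inv₀, map_one, map_ofNat,
      Complex.conj_ofReal]
  have hmul (z w : ℂ) : ∫ ω, f z ω * f w ω ∂P =
      (1 - (a : ℂ) * (Real.cos ω₀ : ℂ) * (z⁻¹ + w⁻¹) + (a : ℂ) ^ 2 * (z * w)⁻¹) /
        ((1 - 2 * (a : ℂ) * (Real.cos ω₀ : ℂ) * z⁻¹ + (a : ℂ) ^ 2 * (z ^ 2)⁻¹) *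
          (1 - 2 * (a : ℂ) * (Real.cos ω₀ : ℂ) * w⁻¹ + (a : ℂ) ^ 2 * (w ^ 2)⁻¹)) := by
    have hnum (z : ℂ) (ω : Ω) : (X ω : ℂ) -
        a * ((X ω : ℂ) * (Real.cos ω₀ : ℂ) - (Y ω : ℂ) * (Real.sin ω₀ : ℂ)) * z⁻¹ =
        (1 - a * (Real.cos ω₀ : ℂ) * z⁻¹) * X ω + (a * (Real.sin ω₀ : ℂ) * z⁻¹) * Y ω := by
      ring
    have htrig : (Real.sin ω₀ : ℂ) ^ 2 + (Real.cos ω₀ : ℂ) ^ 2 = 1 := by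
      exact_mod_cast Real.sin_sq_add_cos_sq ω₀
    simp only [hf, hnum, div_mul_div_comm]
    rw [integral_div, integral_mul_linear_combination_gaussian hX hY hXY hXlaw hYlaw, mul_inv]
    congr 1
    linear_combination (a : ℂ) ^ 2 * z⁻¹ * w⁻¹ * htrig
  intro z w _ _
  refine ⟨?_, hmul z w⟩
  simp only [hconj]
  exact hmul z (conj w)
end

section
/- Let c : ℕ × ℕ → ℂ satisfy ∑_{n,m} |c(n,m)| < ∞. Suppose there exists a function g : ℝ → ℂ such that for all θ, φ ∈ ℝ, ∑_{n,m} c(n,m)·e^{−i(nθ − mφ)} = g(θ − φ). Then c(n,m) = 0 for all n ≠ m. -/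
open Complex

theorem integral_exp_int_mul_I (k : ℤ) :
    (∫ t in (0 : ℝ)..(2 * Real.pi), Complex.exp ((k : ℂ) * I * t)) =
      if k = 0 then (2 * Real.pi : ℂ) else 0 := by
  split_ifs with h
  · simp [h]
  · have hk : (k : ℂ) * I ≠ 0 := mul_ne_zero (Int.cast_ne_zero.mpr h) I_ne_zero
    have hperiod : Complex.exp ((k : ℂ) * I * ((2 * Real.pi : ℝ) : ℂ)) = 1 := by
      rw [Complex.exp_eq_one_iff]
      exact ⟨k, by push_cast; ring⟩
    rw [integral_exp_mul_complex hk, hperiod]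
    simp

/-- Uniqueness of Fourier coefficients for an absolutely convergent trigonometric series, possibly
with repeated frequencies, whose sum is constant. -/
theorem tsum_ite_freq_eq_of_tsum_exp_eq_const {ι : Type*} [Countable ι] {a : ι → ℂ}
    (ha : Summable fun i => ‖a i‖) (k : ι → ℤ) (C : ℂ)
    (h : ∀ t : ℝ, ∑' i, a i * Complex.exp ((k i : ℂ) * I * t) = C) (j : ℤ) :
    ∑' i, (if k i = j then a i else 0) = if j = 0 then C else 0 := by
  have hint := intervalIntegral.hasSum_integral_of_dominated_convergence
    (μ := MeasureTheory.volume) (a := 0) (b := 2 * Real.pi)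
    (F := fun i (t : ℝ) => a i * Complex.exp (((k i - j : ℤ) : ℂ) * I * t))
    (f := fun t : ℝ => C * Complex.exp (((-j : ℤ) : ℂ) * I * t))
    (fun i _ => ‖a i‖)
    (fun i => (by fun_prop : Continuous _).aestronglyMeasurable)
    (fun i => .of_forall fun t _ => by
      have : ((k i - j : ℤ) : ℂ) * I * t = (((k i - j : ℤ) * t : ℝ) : ℂ) * I := by
        push_cast; ring
      rw [norm_mul, this, Complex.norm_exp_ofReal_mul_I, mul_one])
    (.of_forall fun _ _ => ha)
    (by simp)
    (.of_forall fun t _ => by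
      have hs : Summable fun i => a i * Complex.exp ((k i : ℂ) * I * t) := by
        refine .of_norm (ha.congr fun i => ?_)
        have : (k i : ℂ) * I * t = ((k i * t : ℝ) : ℂ) * I := by push_cast; ring
        rw [norm_mul, this, Complex.norm_exp_ofReal_mul_I, mul_one]
      have hC := hs.hasSum
      rw [h t] at hC
      have hexp (i : ι) : a i * Complex.exp ((k i : ℂ) * I * t) *
          Complex.exp (((-j : ℤ) : ℂ) * I * t) =
            a i * Complex.exp (((k i - j : ℤ) : ℂ) * I * t) := by
        rw [mul_assoc, ← Complex.exp_add]
        congr 2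
        push_cast
        ring
      simpa only [hexp] using hC.mul_right (Complex.exp (((-j : ℤ) : ℂ) * I * t)))
  simp only [intervalIntegral.integral_const_mul, integral_exp_int_mul_I, sub_eq_zero,
    neg_eq_zero] at hint
  have hpi : (2 * Real.pi : ℂ) ≠ 0 := by simp [Real.pi_ne_zero]
  apply mul_right_cancel₀ hpi
  rw [← tsum_mul_right]
  simpa only [ite_mul, mul_ite, zero_mul, mul_zero] using hint.tsum_eq

/-- Fourier uniqueness step: if an absolutely convergent double series
`∑ c(n,m) e^{−i(nθ − mφ)}` depends only on `θ − φ`, then `c` is diagonal. -/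
theorem stationary_double_series_diagonal (c : ℕ × ℕ → ℂ)
    (hsum : Summable fun p => ‖c p‖)
    (g : ℝ → ℂ)
    (hg : ∀ θ φ : ℝ,
      (∑' p : ℕ × ℕ, c p * Complex.exp (-Complex.I * ((p.1 : ℂ) * (θ : ℂ) - (p.2 : ℂ) * (φ : ℂ))))
        = g (θ - φ)) :
    ∀ n m : ℕ, n ≠ m → c (n, m) = 0 := by
  intro n m hnm
  have hj : (m : ℤ) - n ≠ 0 := by omega
  have hdiag (α : ℝ) : ∑' p : ℕ × ℕ, (if (p.2 : ℤ) - p.1 = m - n then c p else 0) *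
      Complex.exp (((-p.1 : ℤ) : ℂ) * I * α) = 0 := by
    have hnorm : Summable fun p : ℕ × ℕ =>
        ‖c p * Complex.exp (((-p.1 : ℤ) : ℂ) * I * α)‖ := by
      refine hsum.congr fun p => ?_
      have : ((-p.1 : ℤ) : ℂ) * I * α = (((-p.1 : ℤ) * α : ℝ) : ℂ) * I := by push_cast; ring
      rw [norm_mul, this, Complex.norm_exp_ofReal_mul_I, mul_one]
    have key := tsum_ite_freq_eq_of_tsum_exp_eq_const hnorm (fun p => (p.2 : ℤ) - p.1) (g α)
      (fun t => by
        rw [← add_sub_cancel_right α t, ← hg (α + t) t]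
        refine tsum_congr fun p => ?_
        rw [mul_assoc, ← Complex.exp_add]
        congr 2
        push_cast
        ring) (m - n)
    simpa only [ite_mul, zero_mul, if_neg hj] using key
  have hnorm : Summable fun p : ℕ × ℕ => ‖if (p.2 : ℤ) - p.1 = m - n then c p else 0‖ := by
    refine hsum.of_nonneg_of_le (fun _ => norm_nonneg _) fun p => ?_
    split_ifs <;> simp
  have key := tsum_ite_freq_eq_of_tsum_exp_eq_const hnorm (fun p => -(p.1 : ℤ)) 0 hdiag (-n)
  rw [tsum_eq_single (n, m)] at key
  · simpa using key
  · rintro ⟨a, b⟩ hne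
    have hne' : ¬ (a = n ∧ b = m) := by simpa using hne
    split_ifs <;> first | rfl | (exfalso; omega)
end
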